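/- Consider a feedforward neural network of depth D ≥ 2 with widths n_0 = d, n_1, …, n_{D−1} ∈ ℕ⁺, n_D = 1 and activation ρ : ℝ → ℝ that is differentiable and satisfies |ρ(t)| ≤ 1, |ρ'(t)| ≤ 1 for all t, and both ρ and ρ' are 1-Lipschitz. Let B_θ ≥ 1 and let θ, θ̃ be two parameter vectors whose weights are all bounded by B_θ. Then for every x ∈ ℝ^d with |x_j| ≤ 1 for all j and every p ∈ {1, …, d}, |∂_{x_p} f(x; θ) − ∂_{x_p} f(x; θ̃)| ≤ √W · (D + 1) · B_θ^{2D} · (∏_{i=1}^{D−1} n_i)² · ‖θ − θ̃‖₂. -/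

import Mathlib

/-- Parameters of a feedforward neural network with widths `n 0, n 1, n 2, …`:
`A ℓ` is the `n (ℓ+1) × n ℓ` weight matrix and `b ℓ` the bias vector of layer `ℓ+1`. -/
structure NNParams (n : ℕ → ℕ) where
  A : (ℓ : ℕ) → Fin (n (ℓ + 1)) → Fin (n ℓ) → ℝ
  b : (ℓ : ℕ) → Fin (n (ℓ + 1)) → ℝ

/-- Hidden-layer outputs: `f⁰(x) = x`, `f^{ℓ+1}(x) = ρ(A_{ℓ+1} f^ℓ(x) + b_{ℓ+1})` entrywise. -/
noncomputable def nnHidden {n : ℕ → ℕ} (ρ : ℝ → ℝ) (θ : NNParams n) :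
    (ℓ : ℕ) → ((Fin (n 0) → ℝ) → Fin (n ℓ) → ℝ)
  | 0 => fun x => x
  | ℓ + 1 => fun x q => ρ ((∑ j, θ.A ℓ q j * nnHidden ρ θ ℓ x j) + θ.b ℓ q)

/-- Network output of depth `D`: the last layer is affine (no activation),
`f(x;θ) = A_D f^{D−1}(x;θ) + b_D`. -/
noncomputable def nnOut {n : ℕ → ℕ} (ρ : ℝ → ℝ) (θ : NNParams n) :
    (D : ℕ) → ((Fin (n 0) → ℝ) → Fin (n D) → ℝ)
  | 0 => fun x => x
  | D + 1 => fun x q => (∑ j, θ.A D q j * nnHidden ρ θ D x j) + θ.b D q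

/-- `W`: the total number of scalar parameters of a depth-`D` network. -/
def nnW (n : ℕ → ℕ) (D : ℕ) : ℕ :=
  ∑ ℓ ∈ Finset.range D, (n (ℓ + 1) * n ℓ + n (ℓ + 1))

/-- Squared Euclidean distance between the parameter vectors of two depth-`D` networks. -/
noncomputable def paramSq {n : ℕ → ℕ} (θ θ' : NNParams n) (D : ℕ) : ℝ :=
  ∑ ℓ ∈ Finset.range D,
    ((∑ q, ∑ j, (θ.A ℓ q j - θ'.A ℓ q j) ^ 2) + ∑ q, (θ.b ℓ q - θ'.b ℓ q) ^ 2)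

/-- Euclidean distance `‖θ − θ̃‖₂` between the parameter vectors of two depth-`D` networks. -/
noncomputable def paramDist {n : ℕ → ℕ} (θ θ' : NNParams n) (D : ℕ) : ℝ :=
  Real.sqrt (paramSq θ θ' D)

/-- All weights of the depth-`D` network `θ` are bounded in absolute value by `Bθ`. -/
def weightsBounded {n : ℕ → ℕ} (θ : NNParams n) (D : ℕ) (Bθ : ℝ) : Prop :=
  ∀ ℓ < D, (∀ q j, |θ.A ℓ q j| ≤ Bθ) ∧ (∀ q, |θ.b ℓ q| ≤ Bθ)

/-- `ℓ¹` distance between the parameters of a single layer. -/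
noncomputable def layerDist {n : ℕ → ℕ} (θ η : NNParams n) (ℓ : ℕ) : ℝ :=
  (∑ q, ∑ j, |θ.A ℓ q j - η.A ℓ q j|) + ∑ q, |θ.b ℓ q - η.b ℓ q|

/-- `ℓ¹` distance between the parameter vectors of two depth-`D` networks. -/
noncomputable def paramDistL1 {n : ℕ → ℕ} (θ η : NNParams n) (D : ℕ) : ℝ :=
  ∑ ℓ ∈ Finset.range D, layerDist θ η ℓ

/-- Product of the first `k` hidden widths `n 1, …, n k`. -/
noncomputable def widthProd (n : ℕ → ℕ) (k : ℕ) : ℝ :=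
  ∏ i ∈ Finset.range k, (n (i + 1) : ℝ)

/-- The `p`-th spatial partial derivative at `x` of the depth-`D` network. -/
noncomputable def nnOutDeriv {n : ℕ → ℕ} (ρ : ℝ → ℝ) (θ : NNParams n) (D : ℕ)
    (x : Fin (n 0) → ℝ) (p : Fin (n 0)) (q : Fin (n D)) : ℝ :=
  fderiv ℝ (fun y => nnOut ρ θ D y q) x (Pi.single p 1)

section Distances

variable {n : ℕ → ℕ} (θ θ' : NNParams n)

lemma layerDist_nonneg (ℓ : ℕ) : 0 ≤ layerDist θ θ' ℓ := by
  unfold layerDist; positivity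

lemma paramDistL1_nonneg (D : ℕ) : 0 ≤ paramDistL1 θ θ' D :=
  Finset.sum_nonneg fun ℓ _ => layerDist_nonneg θ θ' ℓ

lemma paramDistL1_succ (D : ℕ) :
    paramDistL1 θ θ' (D + 1) = paramDistL1 θ θ' D + layerDist θ θ' D :=
  Finset.sum_range_succ _ _

lemma row_add_bias_le_layerDist (ℓ : ℕ) (q : Fin (n (ℓ + 1))) :
    (∑ j, |θ.A ℓ q j - θ'.A ℓ q j|) + |θ.b ℓ q - θ'.b ℓ q| ≤ layerDist θ θ' ℓ := by
  refine add_le_add ?_ ?_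
  · exact Finset.single_le_sum (f := fun q => ∑ j, |θ.A ℓ q j - θ'.A ℓ q j|)
      (fun i _ => by positivity) (Finset.mem_univ q)
  · exact Finset.single_le_sum (f := fun q => |θ.b ℓ q - θ'.b ℓ q|)
      (fun i _ => by positivity) (Finset.mem_univ q)

lemma row_le_layerDist (ℓ : ℕ) (q : Fin (n (ℓ + 1))) :
    ∑ j, |θ.A ℓ q j - θ'.A ℓ q j| ≤ layerDist θ θ' ℓ :=
  (le_add_of_nonneg_right (abs_nonneg _)).trans (row_add_bias_le_layerDist θ θ' ℓ q)

lemma layerDist_sq_le (ℓ : ℕ) :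
    layerDist θ θ' ℓ ^ 2 ≤ ((n (ℓ + 1) * n ℓ + n (ℓ + 1) : ℕ) : ℝ) *
      ((∑ q, ∑ j, (θ.A ℓ q j - θ'.A ℓ q j) ^ 2) + ∑ q, (θ.b ℓ q - θ'.b ℓ q) ^ 2) := by
  have h := sq_sum_le_card_mul_sum_sq
    (s := (Finset.univ : Finset ((Fin (n (ℓ + 1)) × Fin (n ℓ)) ⊕ Fin (n (ℓ + 1)))))
    (f := Sum.elim (fun r => |θ.A ℓ r.1 r.2 - θ'.A ℓ r.1 r.2|)
      (fun q => |θ.b ℓ q - θ'.b ℓ q|))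
  simpa [Fintype.sum_sum_type, Fintype.sum_prod_type, layerDist] using h

/-- Cauchy–Schwarz: the `ℓ¹` distance is at most `√W` times the Euclidean one. -/
lemma paramDistL1_le (D : ℕ) :
    paramDistL1 θ θ' D ≤ Real.sqrt (nnW n D) * paramDist θ θ' D := by
  rw [paramDist, ← Real.sqrt_mul (Nat.cast_nonneg _)]
  refine Real.le_sqrt_of_sq_le ?_
  rw [nnW, Nat.cast_sum]
  exact Finset.sum_sq_le_sum_mul_sum_of_sq_le_mul _ (fun _ _ => by positivity)
    (fun _ _ => by positivity) (fun ℓ _ => layerDist_sq_le θ θ' ℓ)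

end Distances

lemma widthProd_succ (n : ℕ → ℕ) (k : ℕ) :
    widthProd n (k + 1) = widthProd n k * n (k + 1) :=
  Finset.prod_range_succ _ _

lemma widthProd_eq_prod_Icc (n : ℕ → ℕ) (k : ℕ) :
    widthProd n k = ∏ i ∈ Finset.Icc 1 k, (n i : ℝ) := by
  induction k with
  | zero => simp [widthProd]
  | succ k ih => rw [widthProd_succ, ih, Finset.prod_Icc_succ_top (by omega)]

lemma one_le_widthProd {n : ℕ → ℕ} {k : ℕ} (h : ∀ i ≤ k, 0 < n i) : 1 ≤ widthProd n k :=
  Finset.prod_induction _ (fun r : ℝ => 1 ≤ r)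
    (fun _ _ => one_le_mul_of_one_le_of_one_le) le_rfl fun i hi => by
      exact_mod_cast h (i + 1) (Finset.mem_range.mp hi)

/-- Perturbation of a dot product in both arguments. -/
lemma abs_sum_mul_sub_sum_mul_le {ι : Type*} [Fintype ι] {a a' c c' : ι → ℝ} {M B E : ℝ}
    (hc : ∀ j, |c j| ≤ M) (ha' : ∀ j, |a' j| ≤ B) (hE : ∀ j, |c j - c' j| ≤ E) :
    |∑ j, a j * c j - ∑ j, a' j * c' j| ≤
      (∑ j, |a j - a' j|) * M + Fintype.card ι * (B * E) := by
  have hsplit : ∑ j, a j * c j - ∑ j, a' j * c' j =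
      ∑ j, ((a j - a' j) * c j + a' j * (c j - c' j)) := by
    rw [← Finset.sum_sub_distrib]
    exact Finset.sum_congr rfl fun j _ => by ring
  have hconst : (Fintype.card ι : ℝ) * (B * E) = ∑ _j : ι, B * E := by simp
  rw [hsplit, hconst, Finset.sum_mul, ← Finset.sum_add_distrib]
  refine (Finset.abs_sum_le_sum_abs _ _).trans (Finset.sum_le_sum fun j _ => ?_)
  refine (abs_add_le _ _).trans (add_le_add ?_ ?_)
  · rw [abs_mul]
    exact mul_le_mul_of_nonneg_left (hc j) (abs_nonneg _)
  · rw [abs_mul]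
    exact mul_le_mul (ha' j) (hE j) (abs_nonneg _) ((abs_nonneg _).trans (ha' j))

section Network

variable {n : ℕ → ℕ} {ρ : ℝ → ℝ}

lemma nnOut_one (θ : NNParams n) (x : Fin (n 0) → ℝ) (q : Fin (n 1)) :
    nnOut ρ θ 1 x q = (∑ j, θ.A 0 q j * x j) + θ.b 0 q := rfl

lemma nnOut_add_two (θ : NNParams n) (k : ℕ) (x : Fin (n 0) → ℝ) (q : Fin (n (k + 2))) :
    nnOut ρ θ (k + 2) x q =
      (∑ j, θ.A (k + 1) q j * ρ (nnOut ρ θ (k + 1) x j)) + θ.b (k + 1) q := rfl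

lemma differentiable_nnOut (hρ : Differentiable ℝ ρ) (θ : NNParams n) (k : ℕ)
    (q : Fin (n (k + 1))) : Differentiable ℝ fun y => nnOut ρ θ (k + 1) y q := by
  induction k with
  | zero =>
    change Differentiable ℝ fun y : Fin (n 0) → ℝ => (∑ j, θ.A 0 q j * y j) + θ.b 0 q
    fun_prop
  | succ k ih =>
    simp only [nnOut_add_two]
    fun_prop

lemma nnOutDeriv_one (θ : NNParams n) (x : Fin (n 0) → ℝ) (p : Fin (n 0))
    (q : Fin (n 1)) : nnOutDeriv ρ θ 1 x p q = θ.A 0 q p := by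
  have h : HasFDerivAt (fun y => nnOut ρ θ 1 y q)
      (∑ j, θ.A 0 q j • (ContinuousLinearMap.proj j : (Fin (n 0) → ℝ) →L[ℝ] ℝ)) x := by
    simp only [nnOut_one]
    exact (HasFDerivAt.fun_sum fun j _ => (hasFDerivAt_apply j x).const_mul _).add_const _
  simp [nnOutDeriv, h.fderiv, Pi.single_apply]

lemma nnOutDeriv_add_two (hρ : Differentiable ℝ ρ) (θ : NNParams n) (k : ℕ)
    (x : Fin (n 0) → ℝ) (p : Fin (n 0)) (q : Fin (n (k + 2))) :
    nnOutDeriv ρ θ (k + 2) x p q = ∑ j, θ.A (k + 1) q j *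
      (deriv ρ (nnOut ρ θ (k + 1) x j) * nnOutDeriv ρ θ (k + 1) x p j) := by
  have h : HasFDerivAt (fun y => nnOut ρ θ (k + 2) y q)
      (∑ j, θ.A (k + 1) q j • (deriv ρ (nnOut ρ θ (k + 1) x j) •
        fderiv ℝ (fun y => nnOut ρ θ (k + 1) y j) x)) x := by
    simp only [nnOut_add_two]
    refine (HasFDerivAt.fun_sum fun j _ => HasFDerivAt.const_mul ?_ _).add_const _
    exact (hρ _).hasDerivAt.comp_hasFDerivAt x (differentiable_nnOut hρ θ k j x).hasFDerivAt
  simp [nnOutDeriv, h.fderiv]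

variable {B : ℝ} {θ θ' : NNParams n} {x : Fin (n 0) → ℝ}

/-- Parameter-Lipschitz bound for the pre-activations. -/
lemma abs_nnOut_sub_le (hρb : ∀ t, |ρ t| ≤ 1) (hρlip : ∀ s t, |ρ s - ρ t| ≤ |s - t|)
    (hB : 1 ≤ B) (hx : ∀ j, |x j| ≤ 1) (k : ℕ) (hpos : ∀ i ≤ k, 0 < n i)
    (hθ' : weightsBounded θ' (k + 1) B) (q : Fin (n (k + 1))) :
    |nnOut ρ θ (k + 1) x q - nnOut ρ θ' (k + 1) x q| ≤
      B ^ k * widthProd n k * paramDistL1 θ θ' (k + 1) := by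
  induction k with
  | zero =>
    have h := abs_sum_mul_sub_sum_mul_le (a := θ.A 0 q) (c' := x) (E := 0) hx
      ((hθ' 0 (by omega)).1 q) (by simp)
    have hrow := row_add_bias_le_layerDist θ θ' 0 q
    simp only [zero_add, paramDistL1, Finset.sum_range_one, widthProd,
      Finset.prod_range_zero, pow_zero, one_mul, mul_one, mul_zero, add_zero] at h hrow ⊢
    rw [nnOut_one, nnOut_one, add_sub_add_comm]
    exact (abs_add_le _ _).trans ((add_le_add_left h _).trans hrow)
  | succ k ih =>
    have ih' := ih (fun i hi => hpos i (by omega)) fun ℓ hℓ => hθ' ℓ (by omega)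
    have h := abs_sum_mul_sub_sum_mul_le (a := θ.A (k + 1) q)
      (fun j => hρb (nnOut ρ θ (k + 1) x j)) ((hθ' (k + 1) (by omega)).1 q)
      (fun j => (hρlip _ _).trans (ih' j))
    have hrow := row_add_bias_le_layerDist θ θ' (k + 1) q
    have hP : 1 ≤ B ^ (k + 1) * widthProd n (k + 1) :=
      one_le_mul_of_one_le_of_one_le (one_le_pow₀ hB) (one_le_widthProd hpos)
    have hmul := le_mul_of_one_le_left (layerDist_nonneg θ θ' (k + 1)) hP
    rw [nnOut_add_two, nnOut_add_two, add_sub_add_comm, paramDistL1_succ θ θ' (k + 1)]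
    rw [Fintype.card_fin] at h
    calc _ ≤ _ := (abs_add_le _ _).trans (add_le_add_left h _)
      _ ≤ B ^ (k + 1) * widthProd n (k + 1) * paramDistL1 θ θ' (k + 1) +
          layerDist θ θ' (k + 1) := by
        rw [widthProd_succ, pow_succ]
        linarith
      _ ≤ _ := by rw [mul_add]; linarith

lemma abs_nnOutDeriv_le (hρ : Differentiable ℝ ρ) (hρ'b : ∀ t, |deriv ρ t| ≤ 1)
    (hB : 1 ≤ B) (p : Fin (n 0)) (k : ℕ) (hθ : weightsBounded θ (k + 1) B)
    (q : Fin (n (k + 1))) :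
    |nnOutDeriv ρ θ (k + 1) x p q| ≤ B ^ (k + 1) * widthProd n k := by
  induction k with
  | zero => simpa [nnOutDeriv_one, widthProd] using (hθ 0 (by omega)).1 q p
  | succ k ih =>
    have ih' := ih fun ℓ hℓ => hθ ℓ (by omega)
    rw [nnOutDeriv_add_two hρ]
    calc _ ≤ ∑ j, |θ.A (k + 1) q j *
          (deriv ρ (nnOut ρ θ (k + 1) x j) * nnOutDeriv ρ θ (k + 1) x p j)| :=
          Finset.abs_sum_le_sum_abs _ _
      _ ≤ ∑ _j : Fin (n (k + 1)), B * (1 * (B ^ (k + 1) * widthProd n k)) := by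
        refine Finset.sum_le_sum fun j _ => ?_
        rw [abs_mul, abs_mul]
        have := (hθ (k + 1) (by omega)).1 q j
        have := hρ'b (nnOut ρ θ (k + 1) x j)
        have := ih' j
        gcongr
      _ = _ := by
        rw [Finset.sum_const, Finset.card_univ, Fintype.card_fin, nsmul_eq_mul, widthProd_succ]
        ring

/-- Parameter-Lipschitz bound for the spatial derivatives, in terms of the `ℓ¹` distance. -/
lemma abs_nnOutDeriv_sub_le (hρ : Differentiable ℝ ρ) (hρb : ∀ t, |ρ t| ≤ 1)
    (hρ'b : ∀ t, |deriv ρ t| ≤ 1) (hρlip : ∀ s t, |ρ s - ρ t| ≤ |s - t|)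
    (hρ'lip : ∀ s t, |deriv ρ s - deriv ρ t| ≤ |s - t|)
    (hB : 1 ≤ B) (hx : ∀ j, |x j| ≤ 1) (p : Fin (n 0)) (k : ℕ) (hpos : ∀ i ≤ k, 0 < n i)
    (hθ : weightsBounded θ (k + 1) B) (hθ' : weightsBounded θ' (k + 1) B)
    (q : Fin (n (k + 1))) :
    |nnOutDeriv ρ θ (k + 1) x p q - nnOutDeriv ρ θ' (k + 1) x p q| ≤
      (k + 1) * (B ^ (k + 1) * widthProd n k) ^ 2 * paramDistL1 θ θ' (k + 1) := by
  induction k with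
  | zero =>
    have hentry : |θ.A 0 q p - θ'.A 0 q p| ≤ layerDist θ θ' 0 :=
      (Finset.single_le_sum (f := fun j => |θ.A 0 q j - θ'.A 0 q j|)
        (fun i _ => abs_nonneg _) (Finset.mem_univ p)).trans (row_le_layerDist θ θ' 0 q)
    have hmul := le_mul_of_one_le_left (layerDist_nonneg θ θ' 0) (one_le_pow₀ hB (n := 2))
    simpa [nnOutDeriv_one, widthProd, paramDistL1] using hentry.trans hmul
  | succ k ih =>
    have hpos' : ∀ i ≤ k, 0 < n i := fun i hi => hpos i (by omega)
    have hθk : weightsBounded θ (k + 1) B := fun ℓ hℓ => hθ ℓ (by omega)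
    have hθk' : weightsBounded θ' (k + 1) B := fun ℓ hℓ => hθ' ℓ (by omega)
    have ih' := ih hpos' hθk hθk'
    have hu := abs_nnOut_sub_le (θ := θ) hρb hρlip hB hx k hpos' hθk'
    have hv := abs_nnOutDeriv_le (x := x) hρ hρ'b hB p k hθk
    have hP := one_le_widthProd hpos'
    have hN : (1 : ℝ) ≤ n (k + 1) := by exact_mod_cast hpos (k + 1) le_rfl
    have hΔ := paramDistL1_nonneg θ θ' (k + 1)
    have hδ := layerDist_nonneg θ θ' (k + 1)
    have hrow := row_le_layerDist θ θ' (k + 1) q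
    generalize hPdef : widthProd n k = P at *
    generalize hΔdef : paramDistL1 θ θ' (k + 1) = Δ at *
    have hc : ∀ j, |deriv ρ (nnOut ρ θ (k + 1) x j) * nnOutDeriv ρ θ (k + 1) x p j| ≤
        B ^ (k + 1) * P := fun j => by
      rw [abs_mul]
      exact (mul_le_of_le_one_left (abs_nonneg _) (hρ'b _)).trans (hv j)
    have hE : ∀ j, |deriv ρ (nnOut ρ θ (k + 1) x j) * nnOutDeriv ρ θ (k + 1) x p j -
        deriv ρ (nnOut ρ θ' (k + 1) x j) * nnOutDeriv ρ θ' (k + 1) x p j| ≤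
        (k + 2) * (B ^ (k + 1) * P) ^ 2 * Δ := fun j => by
      have hu' := (hρ'lip _ _).trans (hu j)
      have hsplit := abs_add_le
        ((deriv ρ (nnOut ρ θ (k + 1) x j) - deriv ρ (nnOut ρ θ' (k + 1) x j)) *
          nnOutDeriv ρ θ (k + 1) x p j)
        (deriv ρ (nnOut ρ θ' (k + 1) x j) *
          (nnOutDeriv ρ θ (k + 1) x p j - nnOutDeriv ρ θ' (k + 1) x p j))
      rw [abs_mul, abs_mul] at hsplit
      have hfst := mul_le_mul hu' (hv j) (abs_nonneg _) (by positivity)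
      have hsnd := (mul_le_of_le_one_left (abs_nonneg _)
        (hρ'b (nnOut ρ θ' (k + 1) x j))).trans (ih' j)
      have hpow : B ^ k * P * Δ * (B ^ (k + 1) * P) ≤ (B ^ (k + 1) * P) ^ 2 * Δ := by
        calc _ = (B ^ k * P) * (B ^ (k + 1) * P) * Δ := by ring
          _ ≤ (B ^ (k + 1) * P) * (B ^ (k + 1) * P) * Δ := by
            gcongr
            omega
          _ = _ := by ring
      calc _ = _ := by congr 1; ring
        _ ≤ _ := hsplit
        _ ≤ _ := by linarith
    have h := abs_sum_mul_sub_sum_mul_le (a := θ.A (k + 1) q) hc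
      ((hθ' (k + 1) (by omega)).1 q) hE
    rw [Fintype.card_fin] at h
    rw [nnOutDeriv_add_two hρ, nnOutDeriv_add_two hρ, paramDistL1_succ θ θ' (k + 1),
      widthProd_succ, hPdef, hΔdef]
    generalize layerDist θ θ' (k + 1) = δ at *
    have hS : 1 ≤ B ^ (k + 1) * P := one_le_mul_of_one_le_of_one_le (one_le_pow₀ hB) hP
    have hBN : 1 ≤ B * n (k + 1) := one_le_mul_of_one_le_of_one_le hB hN
    have htarget : B ^ (k + 1 + 1) * (P * n (k + 1)) =
        (B * n (k + 1)) * (B ^ (k + 1) * P) := by ring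
    rw [htarget]
    generalize B ^ (k + 1) * P = S at *
    have hfst : (∑ j, |θ.A (k + 1) q j - θ'.A (k + 1) q j|) * S ≤
        (k + 2) * ((B * n (k + 1)) * S) ^ 2 * δ := by
      have hT : S ≤ ((B * n (k + 1)) * S) ^ 2 := by
        have hST : S ≤ (B * n (k + 1)) * S := le_mul_of_one_le_left (by linarith) hBN
        exact hST.trans (le_self_pow₀ (hS.trans hST) two_ne_zero)
      calc _ ≤ δ * ((B * n (k + 1)) * S) ^ 2 := by gcongr
        _ = 1 * ((B * n (k + 1)) * S) ^ 2 * δ := by ring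
        _ ≤ _ := by
          gcongr
          linarith [(Nat.cast_nonneg k : (0 : ℝ) ≤ k)]
    have hsnd : n (k + 1) * (B * ((k + 2) * S ^ 2 * Δ)) ≤
        (k + 2) * ((B * n (k + 1)) * S) ^ 2 * Δ := by
      calc _ = (k + 2) * ((B * n (k + 1)) * S ^ 2) * Δ := by ring
        _ ≤ (k + 2) * ((B * n (k + 1)) ^ 2 * S ^ 2) * Δ := by
          gcongr
          exact le_self_pow₀ hBN two_ne_zero
        _ = _ := by ring
    push_cast
    linarith

end Network

/-- **Lemma 5.11: Lipschitz continuity of the spatial derivatives of the network in its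
parameters.** For a depth `D ≥ 2` network with widths `n 0 = d ≥ 1`, …, `n D = 1`,
differentiable activation `ρ` with `|ρ| ≤ 1`, `|ρ'| ≤ 1`, `ρ` and `ρ'` both `1`-Lipschitz,
and parameter vectors `θ, θ̃` with weights bounded by `Bθ ≥ 1`, for every input `x` with
`|x j| ≤ 1` and every input coordinate `p`:
`|∂_{x_p} f(x;θ) − ∂_{x_p} f(x;θ̃)| ≤ √W (D+1) Bθ^{2D} (∏_{i=1}^{D−1} n i)² ‖θ − θ̃‖₂`. -/
theorem nn_derivative_param_lipschitz (D : ℕ) (hD : 2 ≤ D) (n : ℕ → ℕ)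
    (hd : 1 ≤ n 0) (hnD : n D = 1) (hpos : ∀ i ≤ D, 0 < n i)
    (ρ : ℝ → ℝ) (hρdiff : Differentiable ℝ ρ)
    (hρb : ∀ t, |ρ t| ≤ 1) (hρ'b : ∀ t, |deriv ρ t| ≤ 1)
    (hρlip : ∀ s t, |ρ s - ρ t| ≤ |s - t|)
    (hρ'lip : ∀ s t, |deriv ρ s - deriv ρ t| ≤ |s - t|)
    (Bθ : ℝ) (hBθ : 1 ≤ Bθ) (θ θ' : NNParams n)
    (hθ : weightsBounded θ D Bθ) (hθ' : weightsBounded θ' D Bθ)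
    (x : Fin (n 0) → ℝ) (hx : ∀ j, |x j| ≤ 1) (p : Fin (n 0)) :
    ∀ q : Fin (n D),
      |fderiv ℝ (fun y => nnOut ρ θ D y q) x (Pi.single p 1) -
          fderiv ℝ (fun y => nnOut ρ θ' D y q) x (Pi.single p 1)| ≤
        Real.sqrt (nnW n D) * (D + 1) * Bθ ^ (2 * D) *
          (∏ i ∈ Finset.Icc 1 (D - 1), (n i : ℝ)) ^ 2 * paramDist θ θ' D := by
  intro q
  obtain ⟨k, rfl⟩ : ∃ k, D = k + 1 := ⟨D - 1, by omega⟩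
  have h := abs_nnOutDeriv_sub_le hρdiff hρb hρ'b hρlip hρ'lip hBθ hx p k
    (fun i hi => hpos i (by omega)) hθ hθ' q
  have hL1 := paramDistL1_le θ θ' (k + 1)
  have hL0 := paramDistL1_nonneg θ θ' (k + 1)
  rw [Nat.add_sub_cancel, ← widthProd_eq_prod_Icc]
  calc _ ≤ _ := h
    _ ≤ ((k + 1 : ℕ) + 1) * (Bθ ^ (k + 1) * widthProd n k) ^ 2 *
        (Real.sqrt (nnW n (k + 1)) * paramDist θ θ' (k + 1)) := by
      gcongr
      linarith
    _ = _ := by ring
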